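/- Covariance expansion of the variance of the t-th component of the working-MSM efficient influence function: for every t ∈ {1, …, K+1}, σ²_t := E_p[(D*_t)²] = Σ_{d1∈𝒟} Σ_{d2∈𝒟} h(d1,t) h(d2,t) · E_p[ 1{ā(t−1) = d1(l̄(t−1))} · 1{ā(t−1) = d2(l̄(t−1))} · Σ_t(d1,d2)(ā(t−1), l̄(t−1)) / g_{0:t−1}(ā(t−1), l̄(t−1))² ], where Σ_t(d1,d2)(ā(t−1), l̄(t−1)) = Σ_{l_t} q_t(l_t | l̄(t−1), ā(t−1)) · (Q̄^{d1}_{t+1}(l̄(t)) − Q̄^{d1}_t(l̄(t−1))) · (Q̄^{d2}_{t+1}(l̄(t)) − Q̄^{d2}_t(l̄(t−1))). -/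

import Mathlib

/-!
Longitudinal data structure `O = (L(0), A(0), …, A(K), L(K+1))` with full-support pmf `p`.
Histories are encoded by full trajectories together with agreement predicates on time prefixes;
a sum over histories `l̄(t)` is encoded as a sum over full covariate trajectories whose
coordinates beyond `t` are pinned to an arbitrary base point `l₀` (`tailEq`).
-/

open Finset
open scoped Classical

noncomputable section

variable {K : ℕ} {L : Fin (K + 2) → Type} {A : Fin (K + 1) → Type}

/-- Covariate trajectories. -/
abbrev Traj (K : ℕ) (L : Fin (K + 2) → Type) : Type := ∀ s : Fin (K + 2), L s

/-- Treatment trajectories. -/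
abbrev Trt (K : ℕ) (A : Fin (K + 1) → Type) : Type := ∀ s : Fin (K + 1), A s

/-- Observations. -/
abbrev Obs (K : ℕ) (L : Fin (K + 2) → Type) (A : Fin (K + 1) → Type) : Type :=
  Traj K L × Trt K A

/-- Agreement of covariate trajectories on time indices `< t` (i.e. they share `l̄(t-1)`). -/
def aL (t : ℕ) (l l' : Traj K L) : Prop := ∀ s : Fin (K + 2), (s : ℕ) < t → l s = l' s

/-- Agreement of treatment trajectories on time indices `< t` (i.e. they share `ā(t-1)`). -/
def aA (t : ℕ) (a a' : Trt K A) : Prop := ∀ s : Fin (K + 1), (s : ℕ) < t → a s = a' s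

variable [∀ t, Fintype (L t)] [∀ t, Fintype (A t)]

/-- Mass of the event that the covariates agree with `l` on indices `< tL` and the treatments
agree with `a` on indices `< tA`. -/
def marg (p : Obs K L A → ℝ) (tL tA : ℕ) (l : Traj K L) (a : Trt K A) : ℝ :=
  ∑ o' : Obs K L A, if aL tL l o'.1 ∧ aA tA a o'.2 then p o' else 0

/-- The conditional factor `q_t(l_t ∣ l̄(t-1), ā(t-1))`. -/
def qC (p : Obs K L A → ℝ) (t : ℕ) (l : Traj K L) (a : Trt K A) : ℝ :=
  marg p (t + 1) t l a / marg p t t l a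

/-- The treatment mechanism factor `g_t(a_t ∣ l̄(t), ā(t-1))`. -/
def gC (p : Obs K L A → ℝ) (t : ℕ) (l : Traj K L) (a : Trt K A) : ℝ :=
  marg p (t + 1) (t + 1) l a / marg p (t + 1) t l a

/-- The cumulative treatment probability `g_{0:t-1}(ā(t-1), l̄(t-1))`; in particular
`gCum p 0 = 1` is the convention `g_{0:-1} = 1`. -/
def gCum (p : Obs K L A → ℝ) (t : ℕ) (l : Traj K L) (a : Trt K A) : ℝ :=
  ∏ m ∈ Finset.range t, gC p m l a

/-- The treatment trajectory determined by the regimen `d` along the covariates `l`. -/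
def aOf (d : ∀ t : Fin (K + 1), Traj K L → A t) (l : Traj K L) : Trt K A := fun s => d s l

/-- A regimen is adapted: `d_t` depends only on `l̄(t)`. -/
def Adapted (d : ∀ t : Fin (K + 1), Traj K L → A t) : Prop :=
  ∀ t : Fin (K + 1), ∀ l l' : Traj K L, aL ((t : ℕ) + 1) l l' → d t l = d t l'

/-- The event `ā(t-1) = d(l̄(t-1))`. -/
def follows (d : ∀ t : Fin (K + 1), Traj K L → A t) (t : ℕ) (o : Obs K L A) : Prop :=
  ∀ s : Fin (K + 1), (s : ℕ) < t → o.2 s = d s o.1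

/-- The inverse probability weight
`H^d_t(ā(t-1), l̄(t-1)) = 1{ā(t-1) = d(l̄(t-1))} / g_{0:t-1}`; `Hd p d 0 = 1`. -/
def Hd (p : Obs K L A → ℝ) (d : ∀ t : Fin (K + 1), Traj K L → A t) (t : ℕ)
    (o : Obs K L A) : ℝ :=
  (if follows d t o then (1 : ℝ) else 0) / gCum p t o.1 o.2

/-- The sequential regression `Q̄^d_t(l̄(t-1))`, defined downward from
`Q̄^d_{K+2}(l̄(K+1)) = y(l_{K+1})` by
`Q̄^d_t(l̄(t-1)) = Σ_{l_t} q_t(l_t ∣ l̄(t-1), d(l̄(t-1))) Q̄^d_{t+1}(l̄(t))`. -/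
def Qbar (p : Obs K L A → ℝ) (y : L (Fin.last (K + 1)) → ℝ)
    (d : ∀ t : Fin (K + 1), Traj K L → A t) (t : ℕ) (l : Traj K L) : ℝ :=
  if ht : t < K + 2 then
    ∑ v : L ⟨t, ht⟩,
      qC p t (Function.update l ⟨t, ht⟩ v) (aOf d (Function.update l ⟨t, ht⟩ v)) *
        Qbar p y d (t + 1) (Function.update l ⟨t, ht⟩ v)
  else y (l (Fin.last (K + 1)))
termination_by K + 2 - t
decreasing_by omega

/-- The G-computation mass `P^d_t(l̄(t)) = Π_{m=0}^{t} q_m(l_m ∣ l̄(m-1), d(l̄(m-1)))`. -/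
def Pd (p : Obs K L A → ℝ) (d : ∀ t : Fin (K + 1), Traj K L → A t) (t : ℕ)
    (l : Traj K L) : ℝ :=
  ∏ m ∈ Finset.range (t + 1), qC p m l (aOf d l)

/-- `l` agrees with the base point `l₀` on indices `> t`: summing a function of `l̄(t)` over
trajectories pinned to `l₀` beyond `t` realizes the sum over histories `l̄(t)`. -/
def tailEq (t : ℕ) (l₀ l : Traj K L) : Prop := ∀ s : Fin (K + 2), t < (s : ℕ) → l s = l₀ s

/-- The `t`-th component of the efficient influence function,
`D^{*,d}_t = H^d_t · (Q̄^d_{t+1} - Q̄^d_t)` (with `H^d_0 = 1`, so the `t = 0` component is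
`Q̄^d_1(l_0) - Q̄^d_0`). -/
def Dst (p : Obs K L A → ℝ) (y : L (Fin.last (K + 1)) → ℝ)
    (d : ∀ t : Fin (K + 1), Traj K L → A t) (t : ℕ) (o : Obs K L A) : ℝ :=
  Hd p d t o * (Qbar p y d (t + 1) o.1 - Qbar p y d t o.1)

/-- The conditional covariance
`Σ_t(d1,d2)(ā(t-1), l̄(t-1)) = Σ_{l_t} q_t(l_t ∣ l̄(t-1), ā(t-1)) (Q̄^{d1}_{t+1} - Q̄^{d1}_t)(Q̄^{d2}_{t+1} - Q̄^{d2}_t)`. -/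
def Scov (p : Obs K L A → ℝ) (y : L (Fin.last (K + 1)) → ℝ)
    (d1 d2 : ∀ t : Fin (K + 1), Traj K L → A t) (t : ℕ) (ht : t < K + 2)
    (l : Traj K L) (a : Trt K A) : ℝ :=
  ∑ v : L ⟨t, ht⟩,
    qC p t (Function.update l ⟨t, ht⟩ v) a *
      ((Qbar p y d1 (t + 1) (Function.update l ⟨t, ht⟩ v) - Qbar p y d1 t l) *
        (Qbar p y d2 (t + 1) (Function.update l ⟨t, ht⟩ v) - Qbar p y d2 t l))

/-- The `t`-th component of the working-MSM efficient influence function,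
`D*_t = Σ_{d ∈ 𝒟} h(d,t) H^d_t (Q̄^d_{t+1} - Q̄^d_t)` (with `H^d_0 = 1`). -/
def DstM {D : Type} [Fintype D] (p : Obs K L A → ℝ) (y : L (Fin.last (K + 1)) → ℝ)
    (ds : D → ∀ t : Fin (K + 1), Traj K L → A t) (h : D → ℕ → ℝ) (t : ℕ)
    (o : Obs K L A) : ℝ :=
  ∑ i : D, h i t *
    (Hd p (ds i) t o * (Qbar p y (ds i) (t + 1) o.1 - Qbar p y (ds i) t o.1))

theorem aL_symm {K : ℕ} {L : Fin (K + 2) → Type}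
    {t : ℕ} {l l' : Traj K L} (h : aL t l l') : aL t l' l :=
  fun s hs => (h s hs).symm

theorem aL_trans {K : ℕ} {L : Fin (K + 2) → Type}
    {t : ℕ} {l l' l'' : Traj K L} (h : aL t l l') (h' : aL t l' l'') :
    aL t l l'' :=
  fun s hs => (h s hs).trans (h' s hs)

theorem aL_mono {K : ℕ} {L : Fin (K + 2) → Type}
    {t u : ℕ} (htu : t ≤ u) {l l' : Traj K L} (h : aL u l l') : aL t l l' :=
  fun s hs => h s (hs.trans_le htu)

theorem aA_symm {K : ℕ} {A : Fin (K + 1) → Type}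
    {t : ℕ} {a a' : Trt K A} (h : aA t a a') : aA t a' a :=
  fun s hs => (h s hs).symm

theorem aA_trans {K : ℕ} {A : Fin (K + 1) → Type}
    {t : ℕ} {a a' a'' : Trt K A} (h : aA t a a') (h' : aA t a' a'') :
    aA t a a'' :=
  fun s hs => (h s hs).trans (h' s hs)

theorem aA_mono {K : ℕ} {A : Fin (K + 1) → Type}
    {t u : ℕ} (htu : t ≤ u) {a a' : Trt K A} (h : aA u a a') : aA t a a' :=
  fun s hs => h s (hs.trans_le htu)

theorem aL_update_self {K : ℕ} {L : Fin (K + 2) → Type}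
    {t : ℕ} (ht : t < K + 2) (l : Traj K L) (v : L ⟨t, ht⟩) :
    aL t (Function.update l ⟨t, ht⟩ v) l := by
  intro s hs
  exact Function.update_of_ne (fun hst => by simp [hst] at hs) _ _

theorem aL_succ_update_iff {K : ℕ} {L : Fin (K + 2) → Type}
    {t : ℕ} (ht : t < K + 2) (l l' : Traj K L) (v : L ⟨t, ht⟩) :
    aL (t + 1) (Function.update l ⟨t, ht⟩ v) l' ↔ aL t l l' ∧ v = l' ⟨t, ht⟩ := by
  constructor
  · intro h
    refine ⟨aL_trans (aL_symm (aL_update_self ht l v)) (aL_mono t.le_succ h), ?_⟩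
    simpa using h ⟨t, ht⟩ (Nat.lt_succ_self t)
  · rintro ⟨h, rfl⟩ s hs
    rcases Nat.lt_succ_iff_lt_or_eq.mp hs with hlt | heq
    · exact (aL_update_self ht l _ s hlt).trans (h s hlt)
    · obtain rfl : s = ⟨t, ht⟩ := Fin.ext heq
      simp

theorem marg_congr (p : Obs K L A → ℝ) {tL tA : ℕ} {l l' : Traj K L} {a a' : Trt K A}
    (hl : aL tL l l') (ha : aA tA a a') : marg p tL tA l a = marg p tL tA l' a' := by
  unfold marg
  refine Finset.sum_congr rfl fun o _ => if_congr ?_ rfl rfl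
  exact ⟨fun h => ⟨aL_trans (aL_symm hl) h.1, aA_trans (aA_symm ha) h.2⟩,
    fun h => ⟨aL_trans hl h.1, aA_trans ha h.2⟩⟩

theorem marg_pos (p : Obs K L A → ℝ) (hp : ∀ o, 0 < p o) (tL tA : ℕ) (l : Traj K L)
    (a : Trt K A) : 0 < marg p tL tA l a := by
  refine Finset.sum_pos' (fun o _ => ?_) ⟨(l, a), Finset.mem_univ _, ?_⟩
  · split_ifs
    exacts [(hp o).le, le_rfl]
  · rw [if_pos ⟨fun _ _ => rfl, fun _ _ => rfl⟩]
    exact hp _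

theorem qC_congr (p : Obs K L A → ℝ) {t : ℕ} {l l' : Traj K L} {a a' : Trt K A}
    (hl : aL (t + 1) l l') (ha : aA t a a') : qC p t l a = qC p t l' a' := by
  unfold qC
  rw [marg_congr p hl ha, marg_congr p (aL_mono t.le_succ hl) ha]

theorem gCum_congr (p : Obs K L A → ℝ) {t : ℕ} {l l' : Traj K L} {a a' : Trt K A}
    (hl : aL t l l') (ha : aA t a a') : gCum p t l a = gCum p t l' a' := by
  refine Finset.prod_congr rfl fun m hm => ?_
  have hm : m + 1 ≤ t := Finset.mem_range.mp hm
  unfold gC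
  rw [marg_congr p (aL_mono hm hl) (aA_mono hm ha),
    marg_congr p (aL_mono hm hl) (aA_mono (m.le_succ.trans hm) ha)]

theorem aOf_congr {K : ℕ} {L : Fin (K + 2) → Type} {A : Fin (K + 1) → Type}
    {d : ∀ t : Fin (K + 1), Traj K L → A t} (hd : Adapted d) {t : ℕ}
    {l l' : Traj K L} (hl : aL t l l') : aA t (aOf d l) (aOf d l') :=
  fun s hs => hd s l l' (aL_mono hs hl)

theorem follows_congr {K : ℕ} {L : Fin (K + 2) → Type} {A : Fin (K + 1) → Type}
    {d : ∀ t : Fin (K + 1), Traj K L → A t} (hd : Adapted d) {t : ℕ}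
    {l l' : Traj K L} {a a' : Trt K A} (hl : aL t l l') (ha : aA t a a') :
    follows d t (l, a) ↔ follows d t (l', a') :=
  forall₂_congr fun s hs => by
    show a s = d s l ↔ a' s = d s l'
    rw [ha s hs, hd s l l' (aL_mono hs hl)]

theorem Qbar_congr (p : Obs K L A → ℝ) (y : L (Fin.last (K + 1)) → ℝ)
    {d : ∀ t : Fin (K + 1), Traj K L → A t} (hd : Adapted d) (t : ℕ) {l l' : Traj K L}
    (hl : aL t l l') : Qbar p y d t l = Qbar p y d t l' := by
  rw [Qbar, Qbar]
  split_ifs with ht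
  · refine Finset.sum_congr rfl fun v _ => ?_
    have hu : aL (t + 1) (Function.update l ⟨t, ht⟩ v) (Function.update l' ⟨t, ht⟩ v) :=
      (aL_succ_update_iff ht l _ v).mpr
        ⟨aL_trans hl (aL_symm (aL_update_self ht l' v)), by simp⟩
    rw [qC_congr p hu (aOf_congr hd (aL_mono t.le_succ hu)), Qbar_congr p y hd (t + 1) hu]
  · rw [hl (Fin.last (K + 1)) (by simp; omega)]
termination_by K + 2 - t

/-- Tower property: averaging a function of `l̄(t), ā(t-1)` over `l_t` given the past leaves its
expectation unchanged. -/
theorem sum_mul_eq_sum_mul_sum_qC (p : Obs K L A → ℝ) (hp : ∀ o, 0 < p o) {t : ℕ}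
    (ht : t < K + 2) (X : Traj K L → Trt K A → ℝ)
    (hX : ∀ l l' a a', aL (t + 1) l l' → aA t a a' → X l a = X l' a') :
    ∑ o : Obs K L A, p o * X o.1 o.2 =
      ∑ o : Obs K L A, p o * ∑ v : L ⟨t, ht⟩,
        qC p t (Function.update o.1 ⟨t, ht⟩ v) o.2 *
          X (Function.update o.1 ⟨t, ht⟩ v) o.2 := by
  have inner (o : Obs K L A) :
      ∑ v : L ⟨t, ht⟩, qC p t (Function.update o.1 ⟨t, ht⟩ v) o.2 *
          X (Function.update o.1 ⟨t, ht⟩ v) o.2 =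
        ∑ o' : Obs K L A, if aL t o.1 o'.1 ∧ aA t o.2 o'.2 then
          p o' * X o'.1 o'.2 / marg p t t o'.1 o'.2 else 0 := by
    have term (v : L ⟨t, ht⟩) :
        qC p t (Function.update o.1 ⟨t, ht⟩ v) o.2 *
            X (Function.update o.1 ⟨t, ht⟩ v) o.2 =
          ∑ o' : Obs K L A, if v = o'.1 ⟨t, ht⟩ then
            (if aL t o.1 o'.1 ∧ aA t o.2 o'.2 then
              p o' * X o'.1 o'.2 / marg p t t o'.1 o'.2 else 0) else 0 := by
      rw [qC, marg, div_mul_eq_mul_div, Finset.sum_mul, Finset.sum_div]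
      refine Finset.sum_congr rfl fun o' _ => ?_
      by_cases h : aL (t + 1) (Function.update o.1 ⟨t, ht⟩ v) o'.1 ∧ aA t o.2 o'.2
      · have h' := (aL_succ_update_iff ht _ _ _).mp h.1
        rw [if_pos h, if_pos h'.2, if_pos ⟨h'.1, h.2⟩, hX _ _ _ _ h.1 h.2,
          marg_congr p (aL_mono t.le_succ h.1) h.2]
      · rw [if_neg h, zero_mul, zero_div]
        rw [aL_succ_update_iff] at h
        split_ifs with h1 h2
        · exact absurd ⟨⟨h2.1, h1⟩, h2.2⟩ h
        · rfl
        · rfl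
    rw [Finset.sum_congr rfl fun v _ => term v, Finset.sum_comm]
    exact Finset.sum_congr rfl fun o' _ => by simp
  simp_rw [inner, Finset.mul_sum]
  rw [Finset.sum_comm]
  refine Finset.sum_congr rfl fun o' _ => ?_
  have hM := (marg_pos p hp t t o'.1 o'.2).ne'
  calc p o' * X o'.1 o'.2
      = marg p t t o'.1 o'.2 * (p o' * X o'.1 o'.2 / marg p t t o'.1 o'.2) := by
        field_simp
    _ = _ := by
        generalize p o' * X o'.1 o'.2 / marg p t t o'.1 o'.2 = c
        rw [marg, Finset.sum_mul]
        refine Finset.sum_congr rfl fun o _ => ?_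
        have hiff : (aL t o'.1 o.1 ∧ aA t o'.2 o.2) ↔ (aL t o.1 o'.1 ∧ aA t o.2 o'.2) :=
          ⟨fun h => ⟨aL_symm h.1, aA_symm h.2⟩, fun h => ⟨aL_symm h.1, aA_symm h.2⟩⟩
        rw [if_congr hiff rfl rfl, ite_mul, zero_mul, mul_ite, mul_zero]

/-- The expected product of two influence-function components is the expected weighted
conditional covariance. -/
theorem sum_mul_Dst_mul_Dst (p : Obs K L A → ℝ) (hp : ∀ o, 0 < p o)
    (y : L (Fin.last (K + 1)) → ℝ) {d1 d2 : ∀ t : Fin (K + 1), Traj K L → A t}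
    (hd1 : Adapted d1) (hd2 : Adapted d2) {t : ℕ} (ht : t < K + 2) :
    ∑ o : Obs K L A, p o * (Dst p y d1 t o * Dst p y d2 t o) =
      ∑ o : Obs K L A, p o *
        ((if follows d1 t o then (1 : ℝ) else 0) *
          (if follows d2 t o then (1 : ℝ) else 0) *
          Scov p y d1 d2 t ht o.1 o.2 / gCum p t o.1 o.2 ^ 2) := by
  have Hd_congr {d : ∀ t : Fin (K + 1), Traj K L → A t} (hd : Adapted d) {l l' : Traj K L}
      {a a' : Trt K A} (hl : aL t l l') (ha : aA t a a') :
      Hd p d t (l, a) = Hd p d t (l', a') := by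
    unfold Hd
    rw [gCum_congr p hl ha, if_congr (follows_congr hd hl ha) rfl rfl]
  have Dst_congr {d : ∀ t : Fin (K + 1), Traj K L → A t} (hd : Adapted d) {l l' : Traj K L}
      {a a' : Trt K A} (hl : aL (t + 1) l l') (ha : aA t a a') :
      Dst p y d t (l, a) = Dst p y d t (l', a') := by
    have hl' := aL_mono t.le_succ hl
    simp only [Dst]
    rw [Hd_congr hd hl' ha, Qbar_congr p y hd (t + 1) hl, Qbar_congr p y hd t hl']
  rw [sum_mul_eq_sum_mul_sum_qC p hp ht
    (fun l a => Dst p y d1 t (l, a) * Dst p y d2 t (l, a))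
    fun l l' a a' hl ha => by rw [Dst_congr hd1 hl ha, Dst_congr hd2 hl ha]]
  refine Finset.sum_congr rfl fun o _ => congrArg (p o * ·) ?_
  rw [Scov, Finset.mul_sum, Finset.sum_div]
  refine Finset.sum_congr rfl fun v _ => ?_
  have hu := aL_update_self ht o.1 v
  have ha : aA t o.2 o.2 := fun _ _ => rfl
  simp only [Dst]
  rw [Hd_congr hd1 hu ha, Hd_congr hd2 hu ha, Qbar_congr p y hd1 t hu,
    Qbar_congr p y hd2 t hu]
  simp only [Hd]
  ring

/-- covariance expansion of the variance of the `t`-th component of the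
working-MSM efficient influence function. -/
theorem msm_component_variance_expansion [∀ t, Nonempty (L t)] [∀ t, Nonempty (A t)]
    {D : Type} [Fintype D] [Nonempty D]
    (p : Obs K L A → ℝ) (hp : ∀ o, 0 < p o) (hp1 : ∑ o : Obs K L A, p o = 1)
    (y : L (Fin.last (K + 1)) → ℝ)
    (ds : D → ∀ t : Fin (K + 1), Traj K L → A t) (hds : ∀ i, Adapted (ds i))
    (h : D → ℕ → ℝ)
    (t : ℕ) (ht1 : 1 ≤ t) (ht2 : t ≤ K + 1) :
    ∑ o : Obs K L A, p o * DstM p y ds h t o ^ 2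
      = ∑ i : D, ∑ j : D, h i t * h j t *
          ∑ o : Obs K L A, p o *
            ((if follows (ds i) t o then (1 : ℝ) else 0) *
              (if follows (ds j) t o then (1 : ℝ) else 0) *
              Scov p y (ds i) (ds j) t (by omega) o.1 o.2 / gCum p t o.1 o.2 ^ 2) := by
  have expand (o : Obs K L A) : p o * DstM p y ds h t o ^ 2 =
      ∑ i : D, ∑ j : D, h i t * h j t *
        (p o * (Dst p y (ds i) t o * Dst p y (ds j) t o)) := by
    rw [DstM, sq, Finset.sum_mul_sum, Finset.mul_sum]
    refine Finset.sum_congr rfl fun i _ => ?_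
    rw [Finset.mul_sum]
    refine Finset.sum_congr rfl fun j _ => ?_
    simp only [Dst]
    ring
  rw [Finset.sum_congr rfl fun o _ => expand o, Finset.sum_comm]
  refine Finset.sum_congr rfl fun i _ => ?_
  rw [Finset.sum_comm]
  refine Finset.sum_congr rfl fun j _ => ?_
  rw [← Finset.mul_sum, sum_mul_Dst_mul_Dst p hp y (hds i) (hds j)]

end
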